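/- Let 𝒢 be the graphical coordination game on the ring (cycle graph) with n ≥ 3 players and no risk-dominant strategy, i.e. δ₀ = δ₁ = δ > 0. Then the logit dynamics with inverse noise β ≥ 0 satisfies: for every ε ∈ (0,1) and every integer t ≥ (n·(1 + e^{2δβ})/2)·(ln n + ln(1/ε)), ‖P^t(x,·) − π‖_TV ≤ ε for every starting profile x ∈ {0,1}^n. In particular the mixing time is O(e^{2δβ}·n·log n). -/

import Mathlib

noncomputable section

open Finset

/-- Edge potential of the basic 2×2 coordination game:
`φ(0,0) = −δ₀`, `φ(1,1) = −δ₁`, `φ(0,1) = φ(1,0) = 0`. -/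
def coordPhi (δ0 δ1 : ℝ) (a b : Bool) : ℝ :=
  if a = false ∧ b = false then -δ0 else if a = true ∧ b = true then -δ1 else 0

/-- Potential of the graphical coordination game on the (oriented) edge set `E`:
`Φ(x) = ∑_{(u,v) ∈ E} φ(x_u, x_v)`. -/
def graphPot {n : ℕ} (E : Finset (Fin n × Fin n)) (δ0 δ1 : ℝ) (x : Fin n → Bool) : ℝ :=
  ∑ e ∈ E, coordPhi δ0 δ1 (x e.1) (x e.2)

/-- Gibbs measure `π(x) = exp(−β·Φ(x))/Z` on `{0,1}^n`. -/
def gibbsB {n : ℕ} (β : ℝ) (Φ : (Fin n → Bool) → ℝ) (x : Fin n → Bool) : ℝ :=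
  Real.exp (-β * Φ x) / ∑ y : Fin n → Bool, Real.exp (-β * Φ y)

/-- Logit update probability expressed via the potential:
`σ_i(z ∣ x) = exp(−β·Φ(z,x_{−i})) / ∑_{w∈{0,1}} exp(−β·Φ(w,x_{−i}))`. -/
def sigmaB {n : ℕ} (β : ℝ) (Φ : (Fin n → Bool) → ℝ) (i : Fin n) (z : Bool)
    (x : Fin n → Bool) : ℝ :=
  Real.exp (-β * Φ (Function.update x i z)) /
    ∑ w : Bool, Real.exp (-β * Φ (Function.update x i w))

/-- Transition matrix of the logit dynamics with inverse noise `β` on `{0,1}^n`. -/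
def logitPB {n : ℕ} (β : ℝ) (Φ : (Fin n → Bool) → ℝ) :
    Matrix (Fin n → Bool) (Fin n → Bool) ℝ := fun x y =>
  (1 / (n : ℝ)) *
    ∑ i, if y = Function.update x i (y i) then sigmaB β Φ i (y i) x else 0

/-- Total variation distance `(1/2)·∑ z, |μ z − ν z|`. -/
def tvDist {α : Type*} [Fintype α] (μ ν : α → ℝ) : ℝ :=
  (1 / 2) * ∑ z, |μ z - ν z|

/-- Potential of the graphical coordination game on the ring (cycle) with `n` players and
no risk-dominant strategy (`δ₀ = δ₁ = δ`): player `i` plays the basic game with players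
`i−1` and `i+1` (mod `n`). -/
def ringPot (n : ℕ) [NeZero n] (δ : ℝ) (x : Fin n → Bool) : ℝ :=
  ∑ i : Fin n, coordPhi δ δ (x i) (x (i + 1))

/-- `f` changes by at most `L` when a single coordinate is changed. -/
def HammingLipschitz {n : ℕ} (L : ℝ) (f : (Fin n → Bool) → ℝ) : Prop :=
  ∀ x i b, |f (Function.update x i b) - f x| ≤ L

/-- A Hamming-Lipschitz function oscillates by at most the diameter times its constant. -/
lemma HammingLipschitz.abs_sub_le {n : ℕ} {L : ℝ} {f : (Fin n → Bool) → ℝ}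
    (hf : HammingLipschitz L f) (x y : Fin n → Bool) : |f y - f x| ≤ n * L := by
  have key : ∀ s : Finset (Fin n), |f (s.piecewise y x) - f x| ≤ #s * L := by
    intro s
    induction s using Finset.induction_on with
    | empty => simp
    | insert j s hj ih =>
      rw [Finset.piecewise_insert, Finset.card_insert_of_notMem hj]
      have h := _root_.abs_sub_le (f (Function.update (s.piecewise y x) j (y j)))
        (f (s.piecewise y x)) (f x)
      have h' := hf (s.piecewise y x) j (y j)
      push_cast
      linarith
  simpa using key univ

lemma sigmaB_nonneg {n : ℕ} (β : ℝ) (Φ : (Fin n → Bool) → ℝ) (i : Fin n) (z : Bool)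
    (x : Fin n → Bool) : 0 ≤ sigmaB β Φ i z x := by
  unfold sigmaB
  positivity

lemma sigmaB_true_add_false {n : ℕ} (β : ℝ) (Φ : (Fin n → Bool) → ℝ) (i : Fin n)
    (x : Fin n → Bool) : sigmaB β Φ i true x + sigmaB β Φ i false x = 1 := by
  unfold sigmaB
  rw [Fintype.sum_bool, ← add_div]
  exact div_self (by positivity)

lemma sigmaB_update_self {n : ℕ} (β : ℝ) (Φ : (Fin n → Bool) → ℝ) (i : Fin n) (z b : Bool)
    (x : Fin n → Bool) : sigmaB β Φ i z (Function.update x i b) = sigmaB β Φ i z x := by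
  simp [sigmaB]

lemma logitPB_mulVec_apply {n : ℕ} (β : ℝ) (Φ : (Fin n → Bool) → ℝ)
    (f : (Fin n → Bool) → ℝ) (x : Fin n → Bool) :
    (logitPB β Φ).mulVec f x = (1 / (n : ℝ)) * ∑ i, ∑ b,
      sigmaB β Φ i b x * f (Function.update x i b) := by
  simp only [Matrix.mulVec, dotProduct, logitPB, mul_assoc]
  rw [← Finset.mul_sum]
  congr 1
  simp only [Finset.sum_mul]
  rw [Finset.sum_comm]
  refine Finset.sum_congr rfl fun i _ => ?_
  have h : ∀ y : Fin n → Bool,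
      (if y = Function.update x i (y i) then sigmaB β Φ i (y i) x else 0) * f y =
        ∑ b, if y = Function.update x i b
          then sigmaB β Φ i b x * f (Function.update x i b) else 0 := by
    intro y
    rw [Finset.sum_eq_single (y i)]
    · by_cases hy : y = Function.update x i (y i)
      · rw [if_pos hy, if_pos hy, ← hy]
      · rw [if_neg hy, if_neg hy, zero_mul]
    · intro b _ hb
      refine if_neg fun hy => hb ?_
      rw [hy, Function.update_self]
    · simp
  rw [Finset.sum_congr rfl fun y _ => h y, Finset.sum_comm]
  simp

lemma logitPB_mulVec_one {n : ℕ} [NeZero n] (β : ℝ) (Φ : (Fin n → Bool) → ℝ) :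
    (logitPB β Φ).mulVec 1 = 1 := by
  funext x
  have hn : (n : ℝ) ≠ 0 := Nat.cast_ne_zero.mpr (NeZero.ne n)
  rw [logitPB_mulVec_apply]
  simp [sigmaB_true_add_false, hn]

lemma logitPB_pow_mulVec_one {n : ℕ} [NeZero n] (β : ℝ) (Φ : (Fin n → Bool) → ℝ) (t : ℕ) :
    (logitPB β Φ ^ t).mulVec 1 = 1 := by
  induction t with
  | zero => simp
  | succ t ih => rw [pow_succ, ← Matrix.mulVec_mulVec, logitPB_mulVec_one, ih]

lemma sum_gibbsB {n : ℕ} (β : ℝ) (Φ : (Fin n → Bool) → ℝ) : ∑ x, gibbsB β Φ x = 1 := by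
  unfold gibbsB
  rw [← Finset.sum_div]
  exact div_self (by positivity)

/-- Detailed balance for the logit dynamics. -/
lemma gibbsB_mul_logitPB {n : ℕ} (β : ℝ) (Φ : (Fin n → Bool) → ℝ) (x y : Fin n → Bool) :
    gibbsB β Φ x * logitPB β Φ x y = gibbsB β Φ y * logitPB β Φ y x := by
  simp only [logitPB, Finset.mul_sum]
  refine Finset.sum_congr rfl fun i _ => ?_
  by_cases hy : y = Function.update x i (y i)
  · have hx : x = Function.update y i (x i) := by
      rw [hy]
      simp
    have hsum : ∀ b, Function.update y i b = Function.update x i b := by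
      intro b
      rw [hy]
      simp
    rw [if_pos hy, if_pos hx]
    simp only [sigmaB, gibbsB, ← hx, ← hy, hsum]
    ring
  · have hx : ¬ x = Function.update y i (x i) := by
      intro hx
      apply hy
      rw [hx]
      simp
    rw [if_neg hy, if_neg hx]
    simp

lemma gibbsB_vecMul_logitPB {n : ℕ} [NeZero n] (β : ℝ) (Φ : (Fin n → Bool) → ℝ) :
    Matrix.vecMul (gibbsB β Φ) (logitPB β Φ) = gibbsB β Φ := by
  funext y
  have h := congrFun (logitPB_mulVec_one β Φ) y
  simp only [Matrix.mulVec, dotProduct, Pi.one_apply, mul_one] at h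
  simp only [Matrix.vecMul, dotProduct, gibbsB_mul_logitPB]
  rw [← Finset.mul_sum, h, mul_one]

lemma gibbsB_vecMul_logitPB_pow {n : ℕ} [NeZero n] (β : ℝ) (Φ : (Fin n → Bool) → ℝ) (t : ℕ) :
    Matrix.vecMul (gibbsB β Φ) (logitPB β Φ ^ t) = gibbsB β Φ := by
  induction t with
  | zero => simp
  | succ t ih => rw [pow_succ, ← Matrix.vecMul_vecMul, ih, gibbsB_vecMul_logitPB]

/-- Dual form of path coupling: if changing the strategy of one player changes the update
probabilities of the others by at most `D` in total, then the logit dynamics contracts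
Hamming-Lipschitz constants by the factor `1 - (1 - D) / n`. -/
lemma HammingLipschitz.logitPB_mulVec {n : ℕ} [NeZero n] {β : ℝ} {Φ : (Fin n → Bool) → ℝ} {D : ℝ}
    (hD : ∀ x i b, ∑ j ∈ univ.erase i,
      |sigmaB β Φ j true (Function.update x i b) - sigmaB β Φ j true x| ≤ D)
    {L : ℝ} (hL : 0 ≤ L) {f : (Fin n → Bool) → ℝ} (hf : HammingLipschitz L f) :
    HammingLipschitz ((1 - (1 - D) / n) * L) ((logitPB β Φ).mulVec f) := by
  intro x i b
  have hn : (0 : ℝ) < n := Nat.cast_pos.mpr (NeZero.pos n)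
  set y := Function.update x i b with hy
  set d : Fin n → ℝ := fun j =>
    ∑ c, sigmaB β Φ j c y * f (Function.update y j c) -
      ∑ c, sigmaB β Φ j c x * f (Function.update x j c) with hd
  have hi : d i = 0 := by
    simp [hd, hy, sigmaB_update_self]
  have hj : ∀ j ∈ univ.erase i,
      |d j| ≤ L + |sigmaB β Φ j true y - sigmaB β Φ j true x| * L := by
    intro j hj
    have hne : j ≠ i := Finset.ne_of_mem_erase hj
    have hcomm : ∀ c, |f (Function.update y j c) - f (Function.update x j c)| ≤ L := by
      intro c
      rw [hy, Function.update_comm hne.symm]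
      exact hf _ _ _
    have hflip : |f (Function.update x j true) - f (Function.update x j false)| ≤ L := by
      simpa using hf (Function.update x j false) j true
    have hp := sigmaB_true_add_false β Φ j y
    have hq := sigmaB_true_add_false β Φ j x
    have hp1 := sigmaB_nonneg β Φ j true y
    have hp0 := sigmaB_nonneg β Φ j false y
    have hdj : d j =
        (sigmaB β Φ j true y * (f (Function.update y j true) - f (Function.update x j true)) +
          sigmaB β Φ j false y *
            (f (Function.update y j false) - f (Function.update x j false))) +
        (sigmaB β Φ j true y - sigmaB β Φ j true x) *
          (f (Function.update x j true) - f (Function.update x j false)) := by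
      simp only [hd, Fintype.sum_bool]
      linear_combination f (Function.update x j false) * (hp - hq)
    rw [hdj]
    refine (abs_add_le _ _).trans (add_le_add ((abs_add_le _ _).trans ?_) ?_)
    · rw [abs_mul, abs_mul, abs_of_nonneg hp1, abs_of_nonneg hp0]
      calc _ ≤ sigmaB β Φ j true y * L + sigmaB β Φ j false y * L := by
            gcongr <;> exact hcomm _
        _ = L := by rw [← add_mul, hp, one_mul]
    · rw [abs_mul]
      gcongr
  have hsum : |∑ j, d j| ≤ (n - 1 + D) * L := by
    rw [← Finset.add_sum_erase univ d (Finset.mem_univ i), hi, zero_add]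
    refine (Finset.abs_sum_le_sum_abs _ _).trans ((Finset.sum_le_sum hj).trans ?_)
    rw [Finset.sum_add_distrib, ← Finset.sum_mul, Finset.sum_const,
      Finset.card_erase_of_mem (Finset.mem_univ i), Finset.card_univ, Fintype.card_fin,
      nsmul_eq_mul, Nat.cast_pred (NeZero.pos n), ← add_mul]
    gcongr
    exact hD x i b
  rw [logitPB_mulVec_apply, logitPB_mulVec_apply, ← mul_sub, ← Finset.sum_sub_distrib, abs_mul,
    abs_of_pos (by positivity)]
  calc _ ≤ 1 / (n : ℝ) * ((n - 1 + D) * L) := by gcongr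
    _ = _ := by
      field_simp
      ring

lemma HammingLipschitz.logitPB_pow_mulVec {n : ℕ} [NeZero n] {β : ℝ} {Φ : (Fin n → Bool) → ℝ}
    {D : ℝ}
    (hD : ∀ x i b, ∑ j ∈ univ.erase i,
      |sigmaB β Φ j true (Function.update x i b) - sigmaB β Φ j true x| ≤ D)
    (hr : 0 ≤ 1 - (1 - D) / (n : ℝ))
    {L : ℝ} (hL : 0 ≤ L) {f : (Fin n → Bool) → ℝ} (hf : HammingLipschitz L f) (t : ℕ) :
    HammingLipschitz ((1 - (1 - D) / n) ^ t * L) ((logitPB β Φ ^ t).mulVec f) := by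
  induction t with
  | zero => simpa using hf
  | succ t ih =>
    rw [pow_succ' (logitPB β Φ), ← Matrix.mulVec_mulVec, pow_succ', mul_assoc]
    exact ih.logitPB_mulVec hD (by positivity)

/-- Path coupling bound on the distance of the logit dynamics from equilibrium. -/
lemma tvDist_logitPB_pow_le {n : ℕ} [NeZero n] {β : ℝ} {Φ : (Fin n → Bool) → ℝ} {D : ℝ}
    (hD : ∀ x i b, ∑ j ∈ univ.erase i,
      |sigmaB β Φ j true (Function.update x i b) - sigmaB β Φ j true x| ≤ D)
    (hr : 0 ≤ 1 - (1 - D) / (n : ℝ)) (t : ℕ) (x : Fin n → Bool) :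
    tvDist ((logitPB β Φ ^ t) x) (gibbsB β Φ) ≤ n * (1 - (1 - D) / n) ^ t := by
  set f : (Fin n → Bool) → ℝ := fun z =>
    if gibbsB β Φ z ≤ (logitPB β Φ ^ t) x z then 1 / 2 else -(1 / 2) with hf
  have hLip : HammingLipschitz 1 f := by
    intro z i b
    simp only [hf]
    split_ifs <;> norm_num
  set F := (logitPB β Φ ^ t).mulVec f with hF
  have hosc : ∀ y, F x - F y ≤ n * (1 - (1 - D) / n) ^ t := by
    intro y
    have h := (hLip.logitPB_pow_mulVec hD hr zero_le_one t).abs_sub_le y x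
    rw [mul_one] at h
    exact (le_abs_self _).trans h
  have htv : tvDist ((logitPB β Φ ^ t) x) (gibbsB β Φ) = F x - gibbsB β Φ ⬝ᵥ f := by
    simp only [tvDist, hF, Matrix.mulVec, dotProduct]
    rw [← Finset.sum_sub_distrib, Finset.mul_sum]
    refine Finset.sum_congr rfl fun z _ => ?_
    simp only [hf]
    split_ifs with h
    · rw [abs_of_nonneg (by linarith)]
      ring
    · rw [abs_of_neg (by linarith)]
      ring
  have hstat : gibbsB β Φ ⬝ᵥ f = gibbsB β Φ ⬝ᵥ F := by
    rw [hF, Matrix.dotProduct_mulVec, gibbsB_vecMul_logitPB_pow]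
  calc _ = ∑ y, gibbsB β Φ y * (F x - F y) := by
        simp only [mul_sub]
        rw [htv, hstat, Finset.sum_sub_distrib, ← Finset.sum_mul, sum_gibbsB, one_mul]
        rfl
    _ ≤ ∑ y, gibbsB β Φ y * (n * (1 - (1 - D) / n) ^ t) := by
        refine Finset.sum_le_sum fun y _ => mul_le_mul_of_nonneg_left (hosc y) ?_
        unfold gibbsB
        positivity
    _ = _ := by rw [← Finset.sum_mul, sum_gibbsB, one_mul]

lemma sigmaB_true_eq {n : ℕ} (β : ℝ) (Φ : (Fin n → Bool) → ℝ) (i : Fin n) (x : Fin n → Bool) :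
    sigmaB β Φ i true x = 1 / (1 + Real.exp
      (β * (Φ (Function.update x i true) - Φ (Function.update x i false)))) := by
  have h : Real.exp (-β * Φ (Function.update x i false)) =
      Real.exp (-β * Φ (Function.update x i true)) * Real.exp
        (β * (Φ (Function.update x i true) - Φ (Function.update x i false))) := by
    rw [← Real.exp_add]
    congr 1
    ring
  rw [sigmaB, Fintype.sum_bool, h]
  field_simp

/-- The change of an edge potential when an endpoint switches from `0` to `1` while the other
endpoint plays `a`. -/
def edgeGain (δ : ℝ) (a : Bool) : ℝ := if a then -δ else δ

lemma ringPot_update_sub {n : ℕ} [NeZero n] (hn : 3 ≤ n) (δ : ℝ) (x : Fin n → Bool) (j : Fin n) :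
    ringPot n δ (Function.update x j true) - ringPot n δ (Function.update x j false) =
      edgeGain δ (x (j - 1)) + edgeGain δ (x (j + 1)) := by
  have h1 : (1 : Fin n) ≠ 0 := by
    simp [Fin.ext_iff, Nat.mod_eq_of_lt (show 1 < n by omega)]
  have hprev : j - 1 ≠ j := by simpa using h1
  have hnext : j + 1 ≠ j := by simpa using h1
  unfold ringPot
  rw [← Finset.sum_sub_distrib]
  rw [← Finset.sum_subset (Finset.subset_univ {j - 1, j}), Finset.sum_pair hprev]
  · simp only [sub_add_cancel, Function.update_self, Function.update_of_ne hprev,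
      Function.update_of_ne hnext]
    cases x (j - 1) <;> cases x (j + 1) <;> simp [coordPhi, edgeGain]
  · intro k _ hk
    simp only [Finset.mem_insert, Finset.mem_singleton, not_or] at hk
    have hk' : k + 1 ≠ j := fun h => hk.1 (by rw [← h, add_sub_cancel_right])
    simp [Function.update_of_ne hk.2, Function.update_of_ne hk']

/-- Changing one of the two neighbours changes the update probability by at most
`1 / 2 - 1 / (1 + exp (2 δ β))`. -/
lemma abs_logistic_edgeGain_sub_le {δ β : ℝ} (hδ : 0 < δ) (hβ : 0 ≤ β) (a a' c : Bool) :
    |1 / (1 + Real.exp (β * (edgeGain δ a + edgeGain δ c))) -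
      1 / (1 + Real.exp (β * (edgeGain δ a' + edgeGain δ c)))| ≤
      1 / 2 - 1 / (1 + Real.exp (2 * δ * β)) := by
  have hE : 1 ≤ Real.exp (2 * δ * β) := Real.one_le_exp (by positivity)
  have hD : 0 ≤ 1 / 2 - 1 / (1 + Real.exp (2 * δ * β)) :=
    sub_nonneg.mpr (one_div_le_one_div_of_le two_pos (by linarith))
  have hneg : 1 / (1 + Real.exp (β * (-δ + -δ))) = 1 - 1 / (1 + Real.exp (2 * δ * β)) := by
    rw [show β * (-δ + -δ) = -(2 * δ * β) by ring, Real.exp_neg]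
    field_simp
    ring
  have hpos : 1 / (1 + Real.exp (β * (δ + δ))) = 1 / (1 + Real.exp (2 * δ * β)) := by
    ring_nf
  have hzero : 1 / (1 + Real.exp (β * 0)) = 1 / 2 := by
    norm_num
  cases a <;> cases a' <;> cases c <;>
    simp only [edgeGain, if_true, Bool.false_eq_true, if_false, neg_add_cancel, add_neg_cancel,
      hneg, hpos, hzero, sub_self, abs_zero] <;>
    first
    | exact hD
    | (rw [abs_le]; constructor <;> linarith)

lemma sum_abs_sigmaB_ringPot_update_sub_le {n : ℕ} [NeZero n] (hn : 3 ≤ n) {δ β : ℝ}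
    (hδ : 0 < δ) (hβ : 0 ≤ β) (x : Fin n → Bool) (i : Fin n) (b : Bool) :
    ∑ j ∈ univ.erase i, |sigmaB β (ringPot n δ) j true (Function.update x i b) -
      sigmaB β (ringPot n δ) j true x| ≤ 1 - 2 / (1 + Real.exp (2 * δ * β)) := by
  set D := 1 / 2 - 1 / (1 + Real.exp (2 * δ * β)) with hDdef
  have h2 : (1 : Fin n) + 1 ≠ 0 := by
    simp [Fin.ext_iff, Fin.val_add, Nat.mod_eq_of_lt (show 1 < n by omega),
      Nat.mod_eq_of_lt (show 2 < n by omega)]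
  have hD : 0 ≤ D := (abs_nonneg _).trans (abs_logistic_edgeGain_sub_le hδ hβ true true true)
  have hterm : ∀ j, |sigmaB β (ringPot n δ) j true (Function.update x i b) -
      sigmaB β (ringPot n δ) j true x| ≤
        (if j = i + 1 then D else 0) + (if j = i - 1 then D else 0) := by
    intro j
    simp only [sigmaB_true_eq, ringPot_update_sub hn]
    by_cases hprev : j - 1 = i
    · have hj : j = i + 1 := by rw [← hprev, sub_add_cancel]
      have hnext : j + 1 ≠ i := by
        rw [hj, add_assoc]
        simpa using h2
      rw [if_pos hj, Function.update_of_ne hnext]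
      refine (abs_logistic_edgeGain_sub_le hδ hβ _ _ _).trans ?_
      split_ifs <;> linarith
    · rw [Function.update_of_ne hprev]
      by_cases hnext : j + 1 = i
      · have hj : j = i - 1 := by rw [← hnext, add_sub_cancel_right]
        rw [if_pos hj, add_comm (edgeGain δ (x (j - 1))), add_comm (edgeGain δ (x (j - 1)))]
        refine (abs_logistic_edgeGain_sub_le hδ hβ _ _ _).trans ?_
        split_ifs <;> linarith
      · rw [Function.update_of_ne hnext, sub_self, abs_zero]
        split_ifs <;> linarith
  calc _ ≤ ∑ j, |sigmaB β (ringPot n δ) j true (Function.update x i b) -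
        sigmaB β (ringPot n δ) j true x| :=
        Finset.sum_le_sum_of_subset_of_nonneg (Finset.subset_univ _) fun _ _ _ => abs_nonneg _
    _ ≤ ∑ j, ((if j = i + 1 then D else 0) + (if j = i - 1 then D else 0)) :=
        Finset.sum_le_sum fun j _ => hterm j
    _ = 1 - 2 / (1 + Real.exp (2 * δ * β)) := by
        rw [Finset.sum_add_distrib, Finset.sum_ite_eq', Finset.sum_ite_eq']
        simp only [Finset.mem_univ, if_true, hDdef]
        ring

/-- For the graphical coordination game on the ring with `n ≥ 3`
players and no risk-dominant strategy (`δ₀ = δ₁ = δ > 0`), after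
`t ≥ (n·(1 + e^{2δβ})/2)·(ln n + ln(1/ε))` steps the logit dynamics with inverse noise
`β ≥ 0` is within total variation distance `ε` of the Gibbs measure, from every
starting profile; in particular the mixing time is `O(e^{2δβ}·n·log n)`. -/
theorem ring_coordination_mixing_upper_bound
    (n : ℕ) [NeZero n] (hn : 3 ≤ n) (δ β : ℝ) (hδ : 0 < δ) (hβ : 0 ≤ β) :
    ∀ ε : ℝ, 0 < ε → ε < 1 → ∀ t : ℕ,
      ((n : ℝ) * (1 + Real.exp (2 * δ * β)) / 2) *
          (Real.log (n : ℝ) + Real.log (1 / ε)) ≤ (t : ℝ) →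
      ∀ x : Fin n → Bool,
        tvDist ((logitPB β (ringPot n δ) ^ t) x) (gibbsB β (ringPot n δ)) ≤ ε := by
  intro ε hε _ t ht x
  have hn0 : (1 : ℝ) ≤ n := by exact_mod_cast (show 1 ≤ n by omega)
  have hE : 1 ≤ Real.exp (2 * δ * β) := Real.one_le_exp (by positivity)
  set E := Real.exp (2 * δ * β)
  set α : ℝ := 2 / (1 + E) / n with hα
  have hα1 : α ≤ 1 := by
    rw [hα, div_div, div_le_one (by positivity)]
    nlinarith
  have hrate : 1 - (1 - (1 - 2 / (1 + E))) / (n : ℝ) = 1 - α := by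
    rw [sub_sub_cancel]
  have htv := tvDist_logitPB_pow_le (sum_abs_sigmaB_ringPot_update_sub_le hn hδ hβ)
    (by rw [hrate]; linarith) t x
  rw [hrate] at htv
  have hlog : Real.log n + Real.log (1 / ε) ≤ α * t := by
    calc _ = α * ((n : ℝ) * (1 + E) / 2 * (Real.log n + Real.log (1 / ε))) := by
          rw [hα]
          field_simp
      _ ≤ _ := by gcongr
  calc _ ≤ (n : ℝ) * (1 - α) ^ t := htv
    _ ≤ n * Real.exp (-α) ^ t := by
        gcongr
        exact Real.one_sub_le_exp_neg α
    _ = n * Real.exp (-(α * t)) := by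
        rw [← Real.exp_nat_mul]
        ring_nf
    _ ≤ n * Real.exp (-(Real.log n + Real.log (1 / ε))) := by gcongr
    _ = ε := by
        rw [one_div, Real.log_inv, neg_add, neg_neg, Real.exp_add, Real.exp_neg,
          Real.exp_log (by linarith), Real.exp_log hε]
        field_simp
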